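/- Let G be a finite simple forest and let M' be a minimal witness for G, with row set R ⊆ V(G) ⊔ E(G) and column set C ⊆ V(G) ⊔ E(G). Then R = C; that is, M' is a principal submatrix of M(G). -/

import Mathlib

open scoped Classical

/-- The constraint matrix `M(G) = [[I, B], [Bᵀ, I]]` of the total matching IP,
with rows and columns indexed by `V(G) ⊔ E(G)`. -/
noncomputable def totalMatrix {V : Type*} (G : SimpleGraph V) :
    Matrix (V ⊕ G.edgeSet) (V ⊕ G.edgeSet) ℤ := fun a b =>
  match a, b with
  | Sum.inl v, Sum.inl w => if v = w then 1 else 0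
  | Sum.inl v, Sum.inr e => if v ∈ (e : Sym2 V) then 1 else 0
  | Sum.inr e, Sum.inl v => if v ∈ (e : Sym2 V) then 1 else 0
  | Sum.inr e, Sum.inr f => if e = f then 1 else 0

/-- `Δ(G)`: the maximum absolute value of the determinant of a square submatrix of `M(G)`
(the empty submatrix, of determinant `1`, is allowed). -/
noncomputable def maxSubdet {V : Type*} (G : SimpleGraph V) : ℕ :=
  sSup {d : ℕ | ∃ (k : ℕ) (f g : Fin k → (V ⊕ G.edgeSet)),
    Function.Injective f ∧ Function.Injective g ∧
    d = ((totalMatrix G).submatrix f g).det.natAbs}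

/-- Two elements of `V(G) ⊔ E(G)` are incident iff the corresponding entry of `M(G)` is `1`,
i.e. they are equal, or one is an edge and the other an endpoint of that edge. -/
def Incid {V : Type*} (G : SimpleGraph V) (a b : V ⊕ G.edgeSet) : Prop :=
  totalMatrix G a b = 1

/-- The absolute determinant of the square submatrix of `M(G)` with row set `R` and
column set `C`, where `R.card = C.card`. (Well-defined: the choice of bijections with
`Fin R.card` only affects the sign of the determinant.) -/
noncomputable def subdet {V : Type*} (G : SimpleGraph V)
    (R C : Finset (V ⊕ G.edgeSet)) (h : R.card = C.card) : ℕ :=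
  ((totalMatrix G).submatrix
    (fun i : Fin R.card => (R.equivFin.symm i : V ⊕ G.edgeSet))
    (fun i : Fin R.card => (C.equivFin.symm (Fin.cast h i) : V ⊕ G.edgeSet))).det.natAbs

/-- A minimal witness for `G`: a square submatrix of `M(G)`, given by a row set `R` and a
column set `C` with `|R| = |C|`, whose absolute determinant equals `Δ(G)`, and such that
every proper square submatrix has strictly smaller absolute determinant. -/
def IsMinimalWitness {V : Type*} (G : SimpleGraph V)
    (R C : Finset (V ⊕ G.edgeSet)) : Prop :=
  ∃ h : R.card = C.card,
    subdet G R C h = maxSubdet G ∧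
    ∀ (R' C' : Finset (V ⊕ G.edgeSet)) (h' : R'.card = C'.card),
      R' ⊆ R → C' ⊆ C → ¬(R' = R ∧ C' = C) → subdet G R' C' h' < maxSubdet G

theorem subdet_eq_of_range {V : Type*} (G : SimpleGraph V)
    (R C : Finset (V ⊕ G.edgeSet)) (h : R.card = C.card) (k : ℕ)
    (f g : Fin k → (V ⊕ G.edgeSet)) (hf : Function.Injective f) (hg : Function.Injective g)
    (hfR : ∀ x, x ∈ R ↔ x ∈ Set.range f) (hgC : ∀ x, x ∈ C ↔ x ∈ Set.range g) :
    subdet G R C h = ((totalMatrix G).submatrix f g).det.natAbs := by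
  let σ : Fin R.card ≃ Fin k := R.equivFin.symm.trans
    ((Equiv.subtypeEquivRight hfR).trans (Equiv.ofInjective f hf).symm)
  let τ : Fin R.card ≃ Fin k := (finCongr h).trans (C.equivFin.symm.trans
    ((Equiv.subtypeEquivRight hgC).trans (Equiv.ofInjective g hg).symm))
  have h1 : ∀ i, f (σ i) = R.equivFin.symm i := by
    intro i
    simp only [σ, Equiv.trans_apply, Equiv.apply_ofInjective_symm]
    rfl
  have h2 : ∀ i, g (τ i) = C.equivFin.symm (Fin.cast h i) := by
    intro i
    simp only [τ, Equiv.trans_apply, Equiv.apply_ofInjective_symm]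
    rfl
  have := Matrix.abs_det_submatrix_equiv_equiv σ τ ((totalMatrix G).submatrix f g)
  unfold subdet
  simp only [← h1, ← h2]
  exact Int.natAbs_eq_natAbs_iff.mpr (abs_eq_abs.mp this)

theorem totalMatrix_symm {V : Type*} (G : SimpleGraph V) (a b : V ⊕ G.edgeSet) :
    totalMatrix G a b = totalMatrix G b a := by
  rcases a with a | a <;> rcases b with b | b <;> simp [totalMatrix, eq_comm]

/-- Vertices reachable from `w` after deleting `e`, and the edges meeting them. -/
def cutSet {V : Type*} (G : SimpleGraph V) (e : Sym2 V) (w : V) : Set (V ⊕ G.edgeSet) :=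
  {x | match x with
    | Sum.inl v => (G.deleteEdges {e}).Reachable w v
    | Sum.inr f => ∃ v ∈ (f : Sym2 V), (G.deleteEdges {e}).Reachable w v}

theorem reach_of_edge {V : Type*} (G : SimpleGraph V) (e f : Sym2 V) (w x y : V)
    (hf : f ∈ G.edgeSet) (hfe : f ≠ e) (hx : x ∈ f) (hy : y ∈ f)
    (h : (G.deleteEdges {e}).Reachable w x) : (G.deleteEdges {e}).Reachable w y := by
  by_cases hxy : x = y
  · exact hxy ▸ h
  · have : f = s(x, y) := (Sym2.mem_and_mem_iff hxy).mp ⟨hx, hy⟩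
    subst this
    refine h.trans (SimpleGraph.Adj.reachable ?_)
    rw [SimpleGraph.deleteEdges_adj]
    exact ⟨hf, by simpa using hfe⟩

theorem separation {V : Type*} (G : SimpleGraph V) (hG : G.IsAcyclic)
    (s t t' : V ⊕ G.edgeSet) (hst : t ≠ s) (hst' : t' ≠ s) (htt : t ≠ t')
    (ht : totalMatrix G s t ≠ 0) (ht' : totalMatrix G s t' ≠ 0) :
    ∃ K : Set (V ⊕ G.edgeSet), t ∈ K ∧ t' ∉ K ∧
      ∀ a b, a ≠ s → b ≠ s → totalMatrix G a b ≠ 0 → (a ∈ K ↔ b ∈ K) := by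
  have key : ∀ K : Set (V ⊕ G.edgeSet),
      (∀ (x : V) (f : G.edgeSet), (Sum.inl x : V ⊕ G.edgeSet) ≠ s →
        (Sum.inr f : V ⊕ G.edgeSet) ≠ s → x ∈ (f : Sym2 V) →
        ((Sum.inl x : V ⊕ G.edgeSet) ∈ K ↔ (Sum.inr f : V ⊕ G.edgeSet) ∈ K)) →
      ∀ a b, a ≠ s → b ≠ s → totalMatrix G a b ≠ 0 → (a ∈ K ↔ b ∈ K) := by
    intro K hK a b ha hb hab
    rcases a with a | a <;> rcases b with b | b <;> simp [totalMatrix] at hab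
    · rw [hab]
    · exact hK a b ha hb hab
    · exact (hK b a hb ha hab).symm
    · rw [hab]
  have bridge : ∀ v w, G.Adj v w → ¬ (G.deleteEdges {s(v, w)}).Reachable v w := by
    intro v w h
    have := SimpleGraph.isAcyclic_iff_forall_adj_isBridge.mp hG h
    exact (SimpleGraph.isBridge_iff.mp this)
  rcases s with v | e
  · rcases t with t | e
    · simp [totalMatrix] at ht; exact absurd (by rw [ht]) hst
    rcases t' with t' | e'
    · simp [totalMatrix] at ht'; exact absurd (by rw [ht']) hst'
    have hv : v ∈ (e : Sym2 V) := by simpa [totalMatrix] using ht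
    have hv' : v ∈ (e' : Sym2 V) := by simpa [totalMatrix] using ht'
    have hne : (e' : Sym2 V) ≠ e := fun h => htt (by rw [Subtype.ext h])
    obtain ⟨e, he⟩ := e
    obtain ⟨w, rfl⟩ := Sym2.mem_iff_exists.mp hv
    have hb := bridge v w he
    refine ⟨cutSet G s(v, w) w, ⟨w, by simp, SimpleGraph.Reachable.refl _⟩, ?_, key _ ?_⟩
    · rintro ⟨x, hx, hr⟩
      exact hb (reach_of_edge G _ _ w x v e'.2 hne hx hv' hr).symm
    · intro x f hx _ hxf
      constructor
      · intro h
        exact ⟨x, hxf, h⟩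
      · rintro ⟨y, hy, hr⟩
        by_cases hf : (f : Sym2 V) = s(v, w)
        · rw [hf] at hxf
          rcases Sym2.mem_iff.mp hxf with rfl | rfl
          · exact absurd rfl hx
          · exact SimpleGraph.Reachable.refl _
        · exact reach_of_edge G _ _ w y x f.2 hf hy hxf hr
  · rcases t with v | t
    swap
    · simp [totalMatrix] at ht; exact absurd (by rw [ht]) hst
    rcases t' with w | t'
    swap
    · simp [totalMatrix] at ht'; exact absurd (by rw [ht']) hst'
    have hv : v ∈ (e : Sym2 V) := by simpa [totalMatrix] using ht
    have hw : w ∈ (e : Sym2 V) := by simpa [totalMatrix] using ht'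
    have hvw : v ≠ w := fun h => htt (by rw [h])
    obtain ⟨e, he⟩ := e
    obtain rfl : e = s(v, w) := (Sym2.mem_and_mem_iff hvw).mp ⟨hv, hw⟩
    have hb := bridge v w he
    refine ⟨cutSet G s(v, w) v, SimpleGraph.Reachable.refl _, hb, key _ ?_⟩
    intro x f _ hf hxf
    have hf' : (f : Sym2 V) ≠ s(v, w) := by
      intro h
      exact hf (congrArg Sum.inr (Subtype.ext h))
    constructor
    · intro h
      exact ⟨x, hxf, h⟩
    · rintro ⟨y, hy, hr⟩
      exact reach_of_edge G _ _ v y x f.2 hf' hy hxf hr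

theorem count_eq {X : Type*} (M : Matrix X X ℤ) (K : Set X) (k : ℕ) (f g : Fin k → X)
    (hd : (M.submatrix f g).det ≠ 0)
    (hK : ∀ i j, M (f i) (g j) ≠ 0 → (f i ∈ K ↔ g j ∈ K)) :
    ∑ i, (if f i ∈ K then 1 else 0 : ℕ) = ∑ i, (if g i ∈ K then 1 else 0 : ℕ) := by
  rw [Matrix.det_apply] at hd
  obtain ⟨σ, _, hσ⟩ := Finset.exists_ne_zero_of_sum_ne_zero hd
  have hp : ∏ i, M.submatrix f g (σ i) i ≠ 0 := by
    intro h
    exact hσ (by rw [h, smul_zero])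
  rw [Finset.prod_ne_zero_iff] at hp
  rw [← Equiv.sum_comp σ]
  refine Finset.sum_congr rfl fun i _ => ?_
  have := hK (σ i) i (hp i (Finset.mem_univ _))
  simp [this]

theorem core {V : Type*} (G : SimpleGraph V) (hG : G.IsAcyclic) (k : ℕ)
    (f g : Fin (k + 1) → (V ⊕ G.edgeSet)) (hf : Function.Injective f)
    (hg : Function.Injective g) (i₀ : Fin (k + 1)) (hi : ∀ j, g j ≠ f i₀)
    (hd : ((totalMatrix G).submatrix f g).det ≠ 0) :
    ∃ j₀ : Fin (k + 1),
      ((totalMatrix G).submatrix (f ∘ i₀.succAbove) (g ∘ j₀.succAbove)).det.natAbs =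
        ((totalMatrix G).submatrix f g).det.natAbs := by
  have hd' := hd
  rw [Matrix.det_succ_row _ i₀] at hd'
  obtain ⟨j₀, _, hj₀⟩ := Finset.exists_ne_zero_of_sum_ne_zero hd'
  simp only [Matrix.submatrix_apply, Matrix.submatrix_submatrix] at hj₀
  have hA := right_ne_zero_of_mul (left_ne_zero_of_mul hj₀)
  have hD := right_ne_zero_of_mul hj₀
  have h1 : totalMatrix G (f i₀) (g j₀) = 1 := by
    rcases h : f i₀ with a | a <;> rcases h' : g j₀ with b | b <;> rw [h, h'] at hA <;>
      simp [totalMatrix] at hA ⊢ <;> exact hA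
  refine ⟨j₀, ?_⟩
  rw [Matrix.det_succ_row _ i₀, Finset.sum_eq_single j₀]
  · simp only [Matrix.submatrix_apply, Matrix.submatrix_submatrix, h1]
    simp [Int.natAbs_mul, Int.natAbs_pow]
  · intro j _ hj
    simp only [Matrix.submatrix_apply, Matrix.submatrix_submatrix]
    by_contra hne
    have hA' := right_ne_zero_of_mul (left_ne_zero_of_mul hne)
    have hD' := right_ne_zero_of_mul hne
    obtain ⟨K, hK, hK', hcl⟩ := separation G hG (f i₀) (g j₀) (g j) (hi _) (hi _)
      (fun h => hj (hg h).symm) hA hA'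
    have hfi : ∀ i, f (i₀.succAbove i) ≠ f i₀ := fun i h => Fin.succAbove_ne i₀ i (hf h)
    have c1 := count_eq _ K k _ _ hD (fun a b => hcl _ _ (hfi _) (hi _))
    have c2 := count_eq _ K k _ _ hD' (fun a b => hcl _ _ (hfi _) (hi _))
    have s1 := Fin.sum_univ_succAbove (fun c => (if g c ∈ K then 1 else 0 : ℕ)) j₀
    have s2 := Fin.sum_univ_succAbove (fun c => (if g c ∈ K then 1 else 0 : ℕ)) j
    simp only [hK, hK', if_true, if_false, Function.comp] at s1 s2 c1 c2
    omega
  · simp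

/-- If `G` is a finite simple forest and `(R, C)` is a minimal witness for `G`, then
`R = C`; that is, a minimal witness is a principal submatrix of `M(G)`. -/
theorem stmt13 {V : Type*} [Fintype V] (G : SimpleGraph V) (hG : G.IsAcyclic)
    (R C : Finset (V ⊕ G.edgeSet)) (hw : IsMinimalWitness G R C) :
    R = C := by
  obtain ⟨h, hmax, hmin⟩ := hw
  by_contra hne
  have hsub : ¬ R ⊆ C := fun hs => hne (Finset.eq_of_subset_of_card_le hs h.ge)
  obtain ⟨s, hsR, hsC⟩ := Finset.not_subset.mp hsub
  obtain ⟨k, hk⟩ : ∃ k, R.card = k + 1 :=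
    Nat.exists_eq_succ_of_ne_zero (Finset.card_ne_zero_of_mem hsR)
  let f : Fin (k + 1) → (V ⊕ G.edgeSet) := fun i => ((R.equivFinOfCardEq hk).symm i : _)
  let g : Fin (k + 1) → (V ⊕ G.edgeSet) :=
    fun i => ((C.equivFinOfCardEq (h.symm.trans hk)).symm i : _)
  have hf : Function.Injective f := Subtype.val_injective.comp (Equiv.injective _)
  have hg : Function.Injective g := Subtype.val_injective.comp (Equiv.injective _)
  have hfR : ∀ x, x ∈ R ↔ x ∈ Set.range f := fun x =>
    ⟨fun hx => ⟨R.equivFinOfCardEq hk ⟨x, hx⟩, by simp [f]⟩,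
      by rintro ⟨i, rfl⟩; exact ((R.equivFinOfCardEq hk).symm i).2⟩
  have hgC : ∀ x, x ∈ C ↔ x ∈ Set.range g := fun x =>
    ⟨fun hx => ⟨C.equivFinOfCardEq (h.symm.trans hk) ⟨x, hx⟩, by simp [g]⟩,
      by rintro ⟨i, rfl⟩; exact ((C.equivFinOfCardEq (h.symm.trans hk)).symm i).2⟩
  have heq := subdet_eq_of_range G R C h (k + 1) f g hf hg hfR hgC
  obtain ⟨i₀, hi₀⟩ := (hfR s).mp hsR
  have hpos := hmin ∅ ∅ rfl (Finset.empty_subset _) (Finset.empty_subset _)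
    (fun hh => by rw [← hh.1] at hsR; simp at hsR)
  have hd : ((totalMatrix G).submatrix f g).det ≠ 0 := by
    intro h0
    rw [h0] at heq
    simp at heq
    omega
  obtain ⟨j₀, hj₀⟩ := core G hG k f g hf hg i₀
    (fun j hj => hsC (by rw [← hi₀, ← hj]; exact (hgC _).mpr ⟨j, rfl⟩)) hd
  have hf' : Function.Injective (f ∘ i₀.succAbove) := hf.comp Fin.succAbove_right_injective
  have hg' : Function.Injective (g ∘ j₀.succAbove) := hg.comp Fin.succAbove_right_injective
  have hcard : (Finset.univ.image (f ∘ i₀.succAbove)).card =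
      (Finset.univ.image (g ∘ j₀.succAbove)).card := by
    rw [Finset.card_image_of_injective _ hf', Finset.card_image_of_injective _ hg']
  have hlt := hmin (Finset.univ.image (f ∘ i₀.succAbove))
    (Finset.univ.image (g ∘ j₀.succAbove)) hcard
    (by
      intro x hx
      obtain ⟨i, _, rfl⟩ := Finset.mem_image.mp hx
      exact (hfR _).mpr ⟨_, rfl⟩)
    (by
      intro x hx
      obtain ⟨i, _, rfl⟩ := Finset.mem_image.mp hx
      exact (hgC _).mpr ⟨_, rfl⟩)
    (by
      rintro ⟨hR, -⟩
      have := congrArg Finset.card hR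
      rw [Finset.card_image_of_injective _ hf', hk] at this
      simp at this)
  rw [subdet_eq_of_range G _ _ hcard k _ _ hf' hg' (by simp) (by simp), hj₀, ← heq] at hlt
  omega
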